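/- arXiv:2106.11392 — 5 statements merged into one kernel-verified Lean document; each statement's English description precedes it below -/
import Mathlib

section
/- (Brock–Elkies–Jordan fibration over the Fermat–Pell conic.) Let N ≥ 0 and k ≥ 1 be natural numbers, let b₁, …, b_N and a₁, …, a_k be integers, and let E = (E₁₁, E₁₂; E₂₁, E₂₂) := B(b₁)⋯B(b_N) · B(a₁)⋯B(a_k) · B(b_N)⁻¹⋯B(b₁)⁻¹ (computed over ℚ). Then with A = E₂₁, B = E₂₂ − E₁₁, C = −E₁₂, the point (u, v) = (E₂₁, E₂₂) lies on the Fermat–Pell conic: C·E₂₁² − B·E₂₁·E₂₂ + A·E₂₂² = (−1)^k·A. -/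
/-- For a rational number `c`, the matrix `B(c) = ((c, 1), (1, 0))`. -/
def cfMatQ (c : ℚ) : Matrix (Fin 2) (Fin 2) ℚ := !![c, 1; 1, 0]

theorem det_cfMatQ (c : ℚ) : (cfMatQ c).det = -1 := by
  simp [cfMatQ, Matrix.det_fin_two]

theorem det_prod_ofFn_cfMatQ {n : ℕ} (c : Fin n → ℚ) :
    (List.ofFn fun i => cfMatQ (c i)).prod.det = (-1) ^ n := by
  induction n with
  | zero => simp
  | succ n ih =>
    rw [List.ofFn_succ, List.prod_cons, Matrix.det_mul, det_cfMatQ, ih fun i => c i.succ, pow_succ']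

/-- (Brock–Elkies–Jordan fibration over the Fermat–Pell conic.)  Let
`E := B(b₁)⋯B(b_N) · B(a₁)⋯B(a_k) · B(b_N)⁻¹⋯B(b₁)⁻¹` (computed over `ℚ`), with the
`bᵢ`, `aⱼ` integers and `k ≥ 1`.  Then with `A = E₂₁`, `B = E₂₂ − E₁₁`, `C = −E₁₂`,
the point `(u, v) = (E₂₁, E₂₂)` lies on the Fermat–Pell conic
`C·u² − B·u·v + A·v² = (−1)^k·A`. -/
theorem brock_elkies_jordan_point_on_fermat_pell_conic
    (N k : ℕ) (hk : 1 ≤ k) (b : Fin N → ℤ) (a : Fin k → ℤ) :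
    ∀ E : Matrix (Fin 2) (Fin 2) ℚ,
      E = (List.ofFn fun i => cfMatQ (b i : ℚ)).prod *
            (List.ofFn fun j => cfMatQ (a j : ℚ)).prod *
            ((List.ofFn fun i => cfMatQ (b i : ℚ)).prod)⁻¹ →
      (-(E 0 1)) * (E 1 0) ^ 2 - (E 1 1 - E 0 0) * (E 1 0) * (E 1 1)
          + (E 1 0) * (E 1 1) ^ 2 = (-1) ^ k * (E 1 0) := by
  intro E hE
  have hdet : E.det = (-1) ^ k := by
    have hb : (List.ofFn fun i => cfMatQ (b i : ℚ)).prod.det ≠ 0 := by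
      rw [det_prod_ofFn_cfMatQ fun i => (b i : ℚ)]
      exact pow_ne_zero _ (by norm_num)
    rw [hE, Matrix.det_mul, Matrix.det_mul, Matrix.det_nonsing_inv, Ring.inverse_eq_inv',
      det_prod_ofFn_cfMatQ fun j => (a j : ℚ), mul_right_comm, mul_inv_cancel₀ hb, one_mul]
  rw [Matrix.det_fin_two] at hdet
  linear_combination E 1 0 * hdet
end

section
/- Let x be an irrational real number whose continued fraction expansion is eventually periodic of the form [b₁, b₂, …, b_N; overline{a₁, …, a_k}] with N ≥ 1 and k ≥ 1; that is, ⌊x⌋ = b₁, the first N−1 partial denominators of x are b₂, …, b_N, and for every n ≥ 0 the (N−1+n)-th partial denominator equals a_{(n mod k)+1}. Let E = (E₁₁, E₁₂; E₂₁, E₂₂) := B(b₁)⋯B(b_N) · B(a₁)⋯B(a_k) · B(b_N)⁻¹⋯B(b₁)⁻¹. Then E₂₁·x + E₂₂ ≠ 0 and x = (E₁₁·x + E₁₂)/(E₂₁·x + E₂₂). -/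
/-- The successor map on complete quotients of a continued fraction expansion. -/
noncomputable def nextQuotient (x : ℝ) : ℝ := (Int.fract x)⁻¹

theorem Irrational.fract_ne_zero {x : ℝ} (hx : Irrational x) : Int.fract x ≠ 0 := by
  intro h
  exact hx.ne_int ⌊x⌋ (sub_eq_zero.mp h)

theorem Irrational.nextQuotient {x : ℝ} (hx : Irrational x) : Irrational (nextQuotient x) :=
  (hx.sub_intCast ⌊x⌋).inv

theorem Irrational.nextQuotient_iterate {x : ℝ} (hx : Irrational x) (n : ℕ) :
    Irrational (_root_.nextQuotient^[n] x) := by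
  induction n with
  | zero => exact hx
  | succ n ih =>
    rw [Function.iterate_succ_apply']
    exact ih.nextQuotient

theorem GenContFract.of_s_get?_eq_floor_nextQuotient {x : ℝ} (hx : Irrational x) (n : ℕ) :
    (GenContFract.of x).s.get? n = some ⟨1, (⌊nextQuotient^[n + 1] x⌋ : ℝ)⟩ := by
  induction n generalizing x with
  | zero => exact GenContFract.of_s_head hx.fract_ne_zero
  | succ n ih =>
    rw [GenContFract.of_s_succ, Function.iterate_succ_apply]
    exact ih hx.nextQuotient

theorem GenContFract.of_partDens_get?_eq_floor_nextQuotient {x : ℝ} (hx : Irrational x) (n : ℕ) :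
    (GenContFract.of x).partDens.get? n = some (⌊nextQuotient^[n + 1] x⌋ : ℝ) :=
  GenContFract.partDen_eq_s_b (GenContFract.of_s_get?_eq_floor_nextQuotient hx n)

/-- An irrational number is determined by the integer parts of its complete quotients. -/
theorem eq_of_floor_nextQuotient_eq {x y : ℝ} (hx : Irrational x) (hy : Irrational y)
    (h : ∀ n, ⌊nextQuotient^[n] x⌋ = ⌊nextQuotient^[n] y⌋) : x = y := by
  have hof : GenContFract.of x = GenContFract.of y := by
    apply GenContFract.ext
    · rw [GenContFract.of_h_eq_floor, GenContFract.of_h_eq_floor]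
      exact congrArg _ (h 0)
    · apply Stream'.Seq.ext
      intro n
      rw [GenContFract.of_s_get?_eq_floor_nextQuotient hx,
        GenContFract.of_s_get?_eq_floor_nextQuotient hy, h]
  have hconv := GenContFract.of_convergence x
  rw [hof] at hconv
  exact tendsto_nhds_unique hconv (GenContFract.of_convergence y)

/-- The rational matrix `M` sends `u` to `v` as a linear fractional transformation, expressed in
homogeneous coordinates. -/
def MoebiusSends (M : Matrix (Fin 2) (Fin 2) ℚ) (u v : ℝ) : Prop :=
  ∃ c : ℝ, c ≠ 0 ∧ (M.map (Rat.castHom ℝ)).mulVec ![u, 1] = c • ![v, 1]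

theorem MoebiusSends.one (u : ℝ) : MoebiusSends 1 u u :=
  ⟨1, one_ne_zero, by simp⟩

theorem MoebiusSends.mul {M M' : Matrix (Fin 2) (Fin 2) ℚ} {u v w : ℝ}
    (h : MoebiusSends M v w) (h' : MoebiusSends M' u v) : MoebiusSends (M * M') u w := by
  obtain ⟨c, hc, h⟩ := h
  obtain ⟨c', hc', h'⟩ := h'
  refine ⟨c' * c, mul_ne_zero hc' hc, ?_⟩
  rw [Matrix.map_mul, ← Matrix.mulVec_mulVec, h', Matrix.mulVec_smul, h, smul_smul]

theorem MoebiusSends.inv {M : Matrix (Fin 2) (Fin 2) ℚ} {u v : ℝ} (hM : IsUnit M)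
    (h : MoebiusSends M u v) : MoebiusSends M⁻¹ v u := by
  obtain ⟨c, hc, h⟩ := h
  refine ⟨c⁻¹, inv_ne_zero hc, ?_⟩
  have hv : ![v, 1] = c⁻¹ • (M.map (Rat.castHom ℝ)).mulVec ![u, 1] := by
    rw [h, smul_smul, inv_mul_cancel₀ hc, one_smul]
  rw [hv, Matrix.mulVec_smul, Matrix.mulVec_mulVec, ← Matrix.map_mul,
    Matrix.nonsing_inv_mul M ((Matrix.isUnit_iff_isUnit_det M).mp hM)]
  simp

theorem MoebiusSends.denom_ne_zero_and_eq_div {M : Matrix (Fin 2) (Fin 2) ℚ} {u v : ℝ}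
    (h : MoebiusSends M u v) :
    (M 1 0 : ℝ) * u + (M 1 1 : ℝ) ≠ 0 ∧
      v = ((M 0 0 : ℝ) * u + (M 0 1 : ℝ)) / ((M 1 0 : ℝ) * u + (M 1 1 : ℝ)) := by
  obtain ⟨c, hc, h⟩ := h
  have h0 := congrFun h 0
  have h1 := congrFun h 1
  simp [Matrix.mulVec, dotProduct, Fin.sum_univ_two] at h0 h1
  rw [h0, h1]
  exact ⟨hc, by field_simp⟩

theorem isUnit_cfMatQ (c : ℚ) : IsUnit (cfMatQ c) := by
  rw [Matrix.isUnit_iff_isUnit_det]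
  simp [cfMatQ]

theorem isUnit_prod_cfMatQ {n : ℕ} (c : Fin n → ℚ) :
    IsUnit (List.ofFn fun i => cfMatQ (c i)).prod := by
  induction n with
  | zero => simp
  | succ n ih =>
    rw [List.ofFn_succ, List.prod_cons]
    exact (isUnit_cfMatQ _).mul (ih _)

theorem moebiusSends_cfMatQ_floor {x : ℝ} (hx : Irrational x) :
    MoebiusSends (cfMatQ (⌊x⌋ : ℚ)) (nextQuotient x) x := by
  refine ⟨nextQuotient x, inv_ne_zero hx.fract_ne_zero, ?_⟩
  have h : nextQuotient x * x = ⌊x⌋ * nextQuotient x + 1 := by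
    have h1 : nextQuotient x * Int.fract x = 1 := inv_mul_cancel₀ hx.fract_ne_zero
    rw [Int.fract] at h1
    linear_combination h1
  ext i
  fin_cases i <;> simp [cfMatQ, h, Matrix.mulVec, dotProduct, Fin.sum_univ_two]

theorem moebiusSends_prod_cfMatQ {n : ℕ} (c : Fin n → ℤ) {x : ℝ} (hx : Irrational x)
    (hc : ∀ i : Fin n, c i = ⌊nextQuotient^[i] x⌋) :
    MoebiusSends (List.ofFn fun i => cfMatQ (c i : ℚ)).prod (nextQuotient^[n] x) x := by
  induction n generalizing x with
  | zero => simpa using MoebiusSends.one x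
  | succ n ih =>
    rw [List.ofFn_succ, List.prod_cons]
    refine MoebiusSends.mul (v := nextQuotient x) ?_ ?_
    · rw [hc 0]
      exact moebiusSends_cfMatQ_floor hx
    · exact ih _ hx.nextQuotient fun i => hc i.succ

/-- If the continued fraction expansion of an irrational real `x` is eventually periodic
of the form `[b₁, …, b_N; overline{a₁, …, a_k}]`, then `x` is fixed by the linear
fractional transformation given by
`E := B(b₁)⋯B(b_N) · B(a₁)⋯B(a_k) · B(b_N)⁻¹⋯B(b₁)⁻¹`. -/
theorem eventually_periodic_cf_fixed_by_moebius
    (x : ℝ) (hx : Irrational x) (N k : ℕ) (hN : 1 ≤ N) (hk : 1 ≤ k)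
    (b : Fin N → ℤ) (a : Fin k → ℤ)
    (hb0 : b ⟨0, hN⟩ = ⌊x⌋)
    (hb : ∀ i : ℕ, ∀ h : i + 1 < N,
      (GenContFract.of x).partDens.get? i = some ((b ⟨i + 1, h⟩ : ℤ) : ℝ))
    (ha : ∀ n : ℕ,
      (GenContFract.of x).partDens.get? (N - 1 + n) =
        some ((a ⟨n % k, Nat.mod_lt n hk⟩ : ℤ) : ℝ)) :
    ∀ E : Matrix (Fin 2) (Fin 2) ℚ,
      E = (List.ofFn fun i => cfMatQ (b i : ℚ)).prod *
            (List.ofFn fun j => cfMatQ (a j : ℚ)).prod *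
            ((List.ofFn fun i => cfMatQ (b i : ℚ)).prod)⁻¹ →
      ((E 1 0 : ℚ) : ℝ) * x + ((E 1 1 : ℚ) : ℝ) ≠ 0 ∧
        x = (((E 0 0 : ℚ) : ℝ) * x + ((E 0 1 : ℚ) : ℝ)) /
              (((E 1 0 : ℚ) : ℝ) * x + ((E 1 1 : ℚ) : ℝ)) := by
  rintro E rfl
  have hb' : ∀ i : Fin N, b i = ⌊nextQuotient^[i] x⌋ := by
    rintro ⟨_ | i, hi⟩
    · exact hb0
    · have h := hb i hi
      rw [GenContFract.of_partDens_get?_eq_floor_nextQuotient hx] at h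
      exact_mod_cast (Option.some.inj h).symm
  set y := nextQuotient^[N] x
  have hy : Irrational y := hx.nextQuotient_iterate N
  have ha' : ∀ n, a ⟨n % k, Nat.mod_lt n hk⟩ = ⌊nextQuotient^[n] y⌋ := by
    intro n
    have h := ha n
    rw [GenContFract.of_partDens_get?_eq_floor_nextQuotient hx,
      show N - 1 + n + 1 = n + N by omega, Function.iterate_add_apply] at h
    exact_mod_cast (Option.some.inj h).symm
  have hper : nextQuotient^[k] y = y := by
    refine eq_of_floor_nextQuotient_eq (hy.nextQuotient_iterate k) hy fun n => ?_
    rw [← Function.iterate_add_apply, ← ha', ← ha']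
    simp
  have hB := moebiusSends_prod_cfMatQ b hx hb'
  have hA := moebiusSends_prod_cfMatQ a hy fun i => by
    rw [← ha']
    simp [Nat.mod_eq_of_lt i.isLt]
  rw [hper] at hA
  exact ((hB.mul hA).mul (hB.inv (isUnit_prod_cfMatQ _))).denom_ne_zero_and_eq_div
end

section
/- Let x be an irrational real number whose continued fraction expansion is eventually periodic; that is, there exist integers b₁, …, b_N (N ≥ 1) and positive integers a₁, …, a_k (k ≥ 1) such that ⌊x⌋ = b₁, the first N−1 partial denominators of x are b₂, …, b_N, and for every n ≥ 0 the (N−1+n)-th partial denominator equals a_{(n mod k)+1}. Then x is a quadratic irrationality: there exist integers A, B, C, not all zero, such that A·x² + B·x + C = 0. -/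
/-- The complete-quotient map `y ↦ (fract y)⁻¹`, which shifts continued fraction expansions. -/
noncomputable def cfShift (y : ℝ) : ℝ := (Int.fract y)⁻¹

lemma Irrational.fract_pos {y : ℝ} (hy : Irrational y) : 0 < Int.fract y :=
  Int.fract_pos.2 fun h => hy ⟨⌊y⌋, by rw [h]; simp⟩

lemma Irrational.cfShift {y : ℝ} (hy : Irrational y) : Irrational (cfShift y) :=
  (hy.sub_intCast ⌊y⌋).inv

lemma Irrational.iterate_cfShift {y : ℝ} (hy : Irrational y) (n : ℕ) :
    Irrational (_root_.cfShift^[n] y) := by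
  induction n generalizing y with
  | zero => exact hy
  | succ n ih => exact ih hy.cfShift

lemma one_lt_cfShift {y : ℝ} (hy : Irrational y) : 1 < cfShift y :=
  (one_lt_inv₀ hy.fract_pos).2 (Int.fract_lt_one y)

lemma floor_add_inv_cfShift (y : ℝ) : y = ⌊y⌋ + (cfShift y)⁻¹ := by
  simp [cfShift, Int.floor_add_fract]

lemma partDens_iterate_cfShift (y : ℝ) (m n : ℕ) :
    (GenContFract.of (cfShift^[m] y)).partDens.get? n =
      (GenContFract.of y).partDens.get? (m + n) := by
  induction m generalizing y with
  | zero => simp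
  | succ m ih =>
    rw [Function.iterate_succ_apply, ih, Nat.succ_add_eq_add_succ, Nat.add_succ]
    simp only [GenContFract.partDens, Stream'.Seq.map_get?]
    rw [GenContFract.of_s_succ]
    rfl

/-- The sequence of partial denominators determines the fractional part. -/
lemma cfShift_eq_of_partDens_eq {y z : ℝ}
    (h : ∀ n, (GenContFract.of y).partDens.get? n = (GenContFract.of z).partDens.get? n) :
    cfShift y = cfShift z := by
  have hs (v : ℝ) : (GenContFract.of (Int.fract v)).s = (GenContFract.of v).s := by
    ext1 n
    cases n with
    | zero => simp [GenContFract.of_s_head_aux, GenContFract.IntFractPair.stream,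
        GenContFract.IntFractPair.of]
    | succ n => rw [GenContFract.of_s_succ, GenContFract.of_s_succ, Int.fract_fract]
  have hsyz : (GenContFract.of y).s = (GenContFract.of z).s := by
    ext1 n
    have hn := h n
    simp only [GenContFract.partDens, Stream'.Seq.map_get?] at hn
    rcases hy : (GenContFract.of y).s.get? n with _ | p <;>
      rcases hz : (GenContFract.of z).s.get? n with _ | q
    · rfl
    · simp [hy, hz] at hn
    · simp [hy, hz] at hn
    · have hb : p.b = q.b := by simpa [hy, hz] using hn
      have hp := GenContFract.of_partNum_eq_one (GenContFract.partNum_eq_s_a hy)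
      have hq := GenContFract.of_partNum_eq_one (GenContFract.partNum_eq_s_a hz)
      cases p
      cases q
      simp_all
  have hof : GenContFract.of (Int.fract y) = GenContFract.of (Int.fract z) := by
    ext1
    · simp
    · rw [hs, hs, hsyz]
  have hlim := GenContFract.of_convergence (Int.fract y)
  rw [hof] at hlim
  rw [cfShift, cfShift, tendsto_nhds_unique hlim (GenContFract.of_convergence (Int.fract z))]

/-- A number is a Möbius transform, with nonnegative integer coefficients, of each of its
complete quotients. -/
lemma exists_mobius_iterate_cfShift {y : ℝ} (hy : Irrational y) (hy1 : 1 < y) (n : ℕ) :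
    ∃ p q r s : ℤ, 0 < p ∧ 0 ≤ r ∧ (1 ≤ n → 0 < r) ∧
      y * (r * cfShift^[n] y + s) = p * cfShift^[n] y + q := by
  induction n generalizing y with
  | zero => exact ⟨1, 0, 0, 1, by simp⟩
  | succ n ih =>
    obtain ⟨p, q, r, s, hp, hr, -, h⟩ := ih hy.cfShift (one_lt_cfShift hy)
    have ha : 0 < ⌊y⌋ := Int.floor_pos.2 hy1.le
    refine ⟨⌊y⌋ * p + r, ⌊y⌋ * q + s, p, q, by positivity, hp.le, fun _ => hp, ?_⟩
    rw [Function.iterate_succ_apply]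
    have h0 : cfShift y ≠ 0 := (zero_lt_one.trans (one_lt_cfShift hy)).ne'
    have hmul : y * cfShift y = ⌊y⌋ * cfShift y + 1 := by
      conv_lhs => rw [floor_add_inv_cfShift y, add_mul]
      rw [← floor_add_inv_cfShift y, inv_mul_cancel₀ h0]
    push_cast
    linear_combination (⌊y⌋ - y) * h +
      (r * cfShift^[n] (cfShift y) + s) * hmul

/-- `x` is a root of a nonzero integer polynomial of degree at most two. -/
def IsIntQuadraticRoot (x : ℝ) : Prop :=
  ∃ A B C : ℤ, ¬(A = 0 ∧ B = 0 ∧ C = 0) ∧ (A : ℝ) * x ^ 2 + (B : ℝ) * x + (C : ℝ) = 0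

lemma IsIntQuadraticRoot.of_cfShift {y : ℝ} (hy : Irrational y)
    (h : IsIntQuadraticRoot (cfShift y)) : IsIntQuadraticRoot y := by
  obtain ⟨A, B, C, hne, h⟩ := h
  refine ⟨C, B - 2 * ⌊y⌋ * C, A - ⌊y⌋ * B + ⌊y⌋ ^ 2 * C, ?_, ?_⟩
  · rintro ⟨rfl, hB, hA⟩
    obtain rfl : B = 0 := by simpa using hB
    exact hne ⟨by simpa using hA, rfl, rfl⟩
  · have hf := hy.fract_pos.ne'
    rw [cfShift] at h
    field_simp at h
    rw [Int.fract] at h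
    push_cast
    linear_combination h

lemma IsIntQuadraticRoot.of_iterate_cfShift {y : ℝ} (hy : Irrational y) (n : ℕ)
    (h : IsIntQuadraticRoot (cfShift^[n] y)) : IsIntQuadraticRoot y := by
  induction n generalizing y with
  | zero => exact h
  | succ n ih => exact (ih hy.cfShift h).of_cfShift hy

lemma isIntQuadraticRoot_of_iterate_cfShift_eq {y : ℝ} (hy : Irrational y) (hy1 : 1 < y)
    {k : ℕ} (hk : 1 ≤ k) (h : cfShift^[k] y = y) : IsIntQuadraticRoot y := by
  obtain ⟨p, q, r, s, -, -, hr, hm⟩ := exists_mobius_iterate_cfShift hy hy1 k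
  rw [h] at hm
  refine ⟨r, s - p, -q, fun h0 => (hr hk).ne' h0.1, ?_⟩
  push_cast
  linear_combination hm

/-- An irrational real number whose continued fraction expansion is eventually periodic
is a quadratic irrationality: it is a root of a nonzero integer quadratic polynomial. -/
theorem quadratic_of_eventually_periodic_cf
    (x : ℝ) (hx : Irrational x) (N k : ℕ) (hN : 1 ≤ N) (hk : 1 ≤ k)
    (b : Fin N → ℤ) (a : Fin k → ℤ) (hapos : ∀ j : Fin k, 0 < a j)
    (hb0 : b ⟨0, hN⟩ = ⌊x⌋)
    (hb : ∀ i : ℕ, ∀ h : i + 1 < N,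
      (GenContFract.of x).partDens.get? i = some ((b ⟨i + 1, h⟩ : ℤ) : ℝ))
    (ha : ∀ n : ℕ,
      (GenContFract.of x).partDens.get? (N - 1 + n) =
        some ((a ⟨n % k, Nat.mod_lt n hk⟩ : ℤ) : ℝ)) :
    ∃ A B C : ℤ, ¬(A = 0 ∧ B = 0 ∧ C = 0) ∧
      (A : ℝ) * x ^ 2 + (B : ℝ) * x + (C : ℝ) = 0 := by
  set w := cfShift^[N - 1] x with hw
  have hwi : Irrational w := hx.iterate_cfShift _
  have hper : cfShift w = cfShift (cfShift^[k] w) := cfShift_eq_of_partDens_eq fun n => by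
    rw [partDens_iterate_cfShift, hw, partDens_iterate_cfShift, partDens_iterate_cfShift, ha, ha]
    simp only [Nat.add_mod_left]
  have hroot : IsIntQuadraticRoot (cfShift w) :=
    isIntQuadraticRoot_of_iterate_cfShift_eq hwi.cfShift (one_lt_cfShift hwi) hk <| by
      rw [← Function.iterate_succ_apply, Function.iterate_succ_apply', ← hper]
  exact (hroot.of_cfShift hwi).of_iterate_cfShift hx
end

section
/- For every integer t ≥ 3, the continued fraction expansion of θ = (t + √(t² − 4))/2 is [t − 1; overline{1, t − 2}]; that is, ⌊θ⌋ = t − 1 and for every n ≥ 0 the n-th partial denominator of the continued fraction expansion of θ equals 1 if n is even and equals t − 2 if n is odd. -/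
/-- If `x` and `y` are each other's successor under the Gauss map, then the partial denominators of
any `v` with the same fractional part as `x` alternate between `⌊y⌋` and `⌊x⌋`. -/
theorem GenContFract.partDens_of_fract_inv_eq {K : Type*} [Field K] [LinearOrder K]
    [IsStrictOrderedRing K] [FloorRing K] {v x y : K} (hv : Int.fract v = Int.fract x)
    (hx : Int.fract x ≠ 0) (hy : Int.fract y ≠ 0) (hxy : (Int.fract x)⁻¹ = y)
    (hyx : (Int.fract y)⁻¹ = x) (n : ℕ) :
    (GenContFract.of v).partDens.get? n =
      some (if Even n then (⌊y⌋ : K) else (⌊x⌋ : K)) := by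
  induction n generalizing v x y with
  | zero =>
    have h := GenContFract.of_s_head (v := v) (hv ▸ hx)
    rw [hv, hxy] at h
    simpa using GenContFract.partDen_eq_s_b (n := 0) h
  | succ n ih =>
    have h := ih rfl hy hx hyx hxy
    simp only [GenContFract.partDens, Stream'.Seq.map_get?] at h ⊢
    rw [GenContFract.of_s_succ, hv, hxy, h]
    by_cases hn : Even n <;> simp [hn, Nat.even_add_one]

/-- For every integer `t ≥ 3`, the continued fraction expansion of
`θ = (t + √(t² − 4))/2` is `[t − 1; overline{1, t − 2}]`: the floor is `t − 1`, the
even-indexed partial denominators equal `1`, and the odd-indexed ones equal `t − 2`. -/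
theorem cf_of_rm_parameter (t : ℤ) (ht : 3 ≤ t) :
    ∀ θ : ℝ, θ = ((t : ℝ) + Real.sqrt ((t : ℝ) ^ 2 - 4)) / 2 →
      ⌊θ⌋ = t - 1 ∧
        ∀ n : ℕ,
          (GenContFract.of θ).partDens.get? n =
            some (if Even n then (1 : ℝ) else ((t - 2 : ℤ) : ℝ)) := by
  intro θ hθ
  have ht' : (3 : ℝ) ≤ t := by exact_mod_cast ht
  have hlo : (t : ℝ) - 2 < √((t : ℝ) ^ 2 - 4) := Real.lt_sqrt_of_sq_lt (by nlinarith)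
  have hhi : √((t : ℝ) ^ 2 - 4) < t := (Real.sqrt_lt' (by linarith)).2 (by linarith)
  have hs : √((t : ℝ) ^ 2 - 4) ^ 2 = (t : ℝ) ^ 2 - 4 := Real.sq_sqrt (by nlinarith)
  have hquad : θ ^ 2 = t * θ - 1 := by rw [hθ]; linear_combination hs / 4
  have hθlo : (t : ℝ) - 1 < θ := by linarith
  have hθhi : θ < t := by linarith
  have hpos : 0 < θ - 1 := by linarith
  have hfloor : ⌊θ⌋ = t - 1 := by
    rw [Int.floor_eq_iff]; push_cast; constructor <;> linarith
  have hfloor_sub : ⌊θ - 1⌋ = t - 2 := by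
    rw [Int.floor_sub_one, hfloor]; ring
  have hfloor_div : ⌊θ / (θ - 1)⌋ = 1 := by
    rw [Int.floor_eq_iff, le_div_iff₀ hpos, div_lt_iff₀ hpos]
    push_cast; constructor <;> linarith
  have hfract_sub : Int.fract (θ - 1) = θ - t + 1 := by
    rw [Int.fract, hfloor_sub]; push_cast; ring
  have hfract_div : Int.fract (θ / (θ - 1)) = (θ - 1)⁻¹ := by
    rw [Int.fract, hfloor_div]; push_cast; field_simp; ring
  have hne : θ - t + 1 ≠ 0 := by linarith
  refine ⟨hfloor, fun n => ?_⟩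
  have h := GenContFract.partDens_of_fract_inv_eq (v := θ) (x := θ - 1) (y := θ / (θ - 1))
    (Int.fract_sub_one θ).symm (by rwa [hfract_sub]) (by rw [hfract_div]; positivity)
    (by rw [hfract_sub, inv_eq_one_div, div_eq_div_iff hne hpos.ne']; linear_combination -hquad)
    (by rw [hfract_div, inv_inv]) n
  rw [h, hfloor_sub, hfloor_div, Int.cast_one]
end

section
/- For every integer b ≥ 3, the real number θ = (1 + √((b + 2)/(b − 2)))/2 satisfies (b − 2)·θ² − (b − 2)·θ − 1 = 0 and is a fixed point of the linear fractional transformation given by the matrix ((b − 1, 1), (b − 2, 1)): θ = ((b − 1)·θ + 1)/((b − 2)·θ + 1); moreover, the continued fraction expansion of θ is purely periodic with ⌊θ⌋ = 1 and, for every n ≥ 0, the n-th partial denominator of θ equals b − 2 if n is even and equals 1 if n is odd. -/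
/-- If `x = a + 1 / y` with `a` an integer and `y > 1`, then `a` is the floor of `x`. -/
theorem floor_eq_of_eq_add_inv {x y : ℝ} {a : ℤ} (h : x = a + y⁻¹) (hy : 1 < y) : ⌊x⌋ = a := by
  rw [Int.floor_eq_iff, h]
  have h0 : 0 < y⁻¹ := inv_pos.mpr (by linarith)
  have h1 : y⁻¹ < 1 := inv_lt_one_of_one_lt₀ hy
  constructor <;> linarith

/-- If `x = a + 1 / y` with `a` an integer and `y > 1`, then `y` is the first complete quotient
of `x`. -/
theorem inv_fract_eq_of_eq_add_inv {x y : ℝ} {a : ℤ} (h : x = a + y⁻¹) (hy : 1 < y) :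
    (Int.fract x)⁻¹ = y := by
  rw [Int.fract, floor_eq_of_eq_add_inv h hy, h, add_sub_cancel_left, inv_inv]

/-- If `x = a + 1 / y` and `y = c + 1 / x` with integers `a`, `c` and `x, y > 1`, then the
partial denominators of `x` alternate between `c` and `a`. -/
theorem partDens_get?_of_period_two {x y : ℝ} {a c : ℤ} (hx : 1 < x) (hy : 1 < y)
    (hxy : x = a + y⁻¹) (hyx : y = c + x⁻¹) (n : ℕ) :
    (GenContFract.of x).partDens.get? n = some (if Even n then (c : ℝ) else (a : ℝ)) := by
  have key : (GenContFract.of x).s.get? n =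
      some ⟨1, if Even n then (c : ℝ) else (a : ℝ)⟩ := by
    induction n generalizing x y a c with
    | zero =>
      have hne : Int.fract x ≠ 0 := by
        intro h0
        have := inv_fract_eq_of_eq_add_inv hxy hy
        rw [h0, inv_zero] at this
        linarith
      have := GenContFract.of_s_head hne
      rw [inv_fract_eq_of_eq_add_inv hxy hy, floor_eq_of_eq_add_inv hyx hx] at this
      simpa [Stream'.Seq.head] using this
    | succ n ih =>
      rw [GenContFract.of_s_succ, inv_fract_eq_of_eq_add_inv hxy hy, ih hy hx hyx hxy]
      by_cases hn : Even n <;> simp [Nat.even_add_one, hn]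
  exact GenContFract.partDen_eq_s_b key

/-- For every integer `b ≥ 3`, the number `θ = (1 + √((b + 2)/(b − 2)))/2` satisfies
`(b − 2)·θ² − (b − 2)·θ − 1 = 0`, is a fixed point of the linear fractional
transformation given by `((b − 1, 1), (b − 2, 1))`, and its continued fraction
expansion is purely periodic with floor `1`, even-indexed partial denominators `b − 2`
and odd-indexed ones `1`. -/
theorem cf_of_legendre_parameter (b : ℤ) (hb : 3 ≤ b) :
    ∀ θ : ℝ, θ = (1 + Real.sqrt (((b : ℝ) + 2) / ((b : ℝ) - 2))) / 2 →
      ((b : ℝ) - 2) * θ ^ 2 - ((b : ℝ) - 2) * θ - 1 = 0 ∧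
      θ = (((b : ℝ) - 1) * θ + 1) / (((b : ℝ) - 2) * θ + 1) ∧
      ⌊θ⌋ = 1 ∧
      ∀ n : ℕ,
        (GenContFract.of θ).partDens.get? n =
          some (if Even n then ((b - 2 : ℤ) : ℝ) else (1 : ℝ)) := by
  intro θ hθ
  have hc : (1 : ℝ) ≤ (b : ℝ) - 2 := by
    have : (3 : ℝ) ≤ b := by exact_mod_cast hb
    linarith
  have hc0 : (b : ℝ) - 2 ≠ 0 := by linarith
  have hquad : ((b : ℝ) - 2) * θ ^ 2 - ((b : ℝ) - 2) * θ - 1 = 0 := by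
    have hs : Real.sqrt (((b : ℝ) + 2) / ((b : ℝ) - 2)) ^ 2 = ((b : ℝ) + 2) / ((b : ℝ) - 2) :=
      Real.sq_sqrt (div_nonneg (by linarith) (by linarith))
    rw [eq_div_iff hc0] at hs
    rw [hθ]
    linear_combination hs / 4
  have h1 : 1 < θ := by
    have : 1 < Real.sqrt (((b : ℝ) + 2) / ((b : ℝ) - 2)) := by
      rw [Real.lt_sqrt zero_le_one, lt_div_iff₀ (by linarith)]
      linarith
    linarith
  have hθ0 : θ ≠ 0 := by linarith
  have hy : 1 < ((b : ℝ) - 2) * θ := by nlinarith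
  have hxy : θ = ((1 : ℤ) : ℝ) + (((b : ℝ) - 2) * θ)⁻¹ := by
    push_cast
    field_simp
    linear_combination hquad
  have hyx : ((b : ℝ) - 2) * θ = ((b - 2 : ℤ) : ℝ) + θ⁻¹ := by
    push_cast
    field_simp
    linear_combination hquad
  refine ⟨hquad, ?_, floor_eq_of_eq_add_inv hxy hy, fun n => ?_⟩
  · rw [eq_div_iff (by linarith)]
    linear_combination hquad
  · simpa only [Int.cast_one] using partDens_get?_of_period_two h1 hy hxy hyx n
end
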